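/- arXiv:1607.05133 — 11 statements merged into one kernel-verified Lean document; each statement's English description precedes it below -/
import Mathlib

section
/- For any coordinate q ∈ {1,…,R}, after removing from D^M the vertex set V_q = {v^α_x : α ∈ {1,…,r}^k, x_q = * or x_q = 0}, there is no directed path from s_i to t_i for any i ∈ {1,…,k}. -/
/-- Vertices of the Directed Multicut dictatorship test `D^M`:
terminals `s_i`, `t_i` for `i ∈ {1,…,k}`, and `v^α_x` for `α ∈ {1,…,r}^k`
(encoded by `α : Fin k → Fin r`, the value of `α_i` being `(α i).val + 1 ∈ {1,…,r}`)
and `x ∈ Ω^R` where `Ω = {0,…,r-1,*}` is encoded by `Option (ZMod r)` with `none = *`. -/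
inductive MV (k r R : ℕ) where
  | s (i : Fin k)
  | t (i : Fin k)
  | v (α : Fin k → Fin r) (x : Fin R → Option (ZMod r))

/-- One-coordinate condition on nonterminal edges of `D^M`:
either `x_j, y_j ∈ {0,…,r-1}` and `y_j = x_j + 1 (mod r)`, or `y_j = *`, or `x_j = *`. -/
def mvStep {r : ℕ} (x y : Option (ZMod r)) : Prop :=
  (∃ c : ZMod r, x = some c ∧ y = some (c + 1)) ∨ y = none ∨ x = none

/-- Directed edges of `D^M`: `s_i → v^α_x` iff `α_i = 1`; `v^α_x → t_i` iff `α_i = r`;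
`v^α_x → v^β_y` iff `α ≠ β`, `|α_i - β_i| ≤ 1` for all `i`, and every coordinate
satisfies `mvStep`. -/
def mvEdge {k r R : ℕ} : MV k r R → MV k r R → Prop
  | .s i, .v α _ => (α i).val = 0
  | .v α _, .t i => (α i).val = r - 1
  | .v α x, .v β y =>
      α ≠ β ∧ (∀ i, (α i).val ≤ (β i).val + 1 ∧ (β i).val ≤ (α i).val + 1) ∧
        ∀ j, mvStep (x j) (y j)
  | _, _ => False

/-- The dictator cut `V_q = {v^α_x : x_q = * or x_q = 0}`. -/
def mvCut {k r R : ℕ} (q : Fin R) : Set (MV k r R) :=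
  {z | ∃ α x, z = MV.v α x ∧ (x q = none ∨ x q = some 0)}

theorem ZMod.val_add_one_of_add_one_ne_zero {n : ℕ} [NeZero n] {c : ZMod n} (h : c + 1 ≠ 0) :
    (c + 1).val = c.val + 1 := by
  rcases Nat.lt_or_ge (c.val + 1) n with hlt | hge
  · have hcast : ((c.val + 1 : ℕ) : ZMod n) = c + 1 := by simp
    rw [← hcast, ZMod.val_natCast, Nat.mod_eq_of_lt hlt]
  · refine absurd ?_ h
    have hn : c.val + 1 = n := le_antisymm (ZMod.val_lt c) hge
    have hcast : ((c.val + 1 : ℕ) : ZMod n) = c + 1 := by simp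
    rw [← hcast, hn, ZMod.natCast_self]

theorem v_notMem_mvCut_iff {k r R : ℕ} {q : Fin R} {α : Fin k → Fin r}
    {x : Fin R → Option (ZMod r)} :
    MV.v α x ∉ mvCut q ↔ ∃ c : ZMod r, x q = some c ∧ c ≠ 0 := by
  cases h : x q <;> simp [mvCut, h]

/-- Outside the cut, the residue `x_q` stays strictly above the grid coordinate `α_i` along a
path, so the path cannot end at `t_i`. -/
theorem not_isChain_of_lt_val {k r R : ℕ} [NeZero r] {q : Fin R} {i : Fin k}
    (p : List (MV k r R)) (hp : ∀ z ∈ p, z ∉ mvCut q) {α : Fin k → Fin r}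
    {x : Fin R → Option (ZMod r)} {c : ZMod r} (hx : x q = some c) (hc : (α i).val < c.val) :
    ¬ List.IsChain mvEdge (MV.v α x :: (p ++ [MV.t i])) := by
  induction p generalizing α x c with
  | nil =>
    intro h
    have hα : (α i).val = r - 1 := by simpa [mvEdge] using h
    have := ZMod.val_lt c
    omega
  | cons z p ih =>
    intro h
    rw [List.cons_append, List.isChain_cons_cons] at h
    obtain ⟨hz, h⟩ := h
    cases z with
    | s j => exact hz
    | t j =>
      cases p with
      | nil => simp [mvEdge] at h
      | cons w p =>
        rw [List.cons_append, List.isChain_cons_cons] at h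
        exact h.1
    | v β y =>
      obtain ⟨d, hy, hd⟩ := v_notMem_mvCut_iff.1 (hp _ List.mem_cons_self)
      refine ih (fun w hw => hp w (List.mem_cons_of_mem _ hw)) hy ?_ h
      obtain ⟨-, hstep, hq⟩ := hz
      have hdc : d = c + 1 := by simpa [mvStep, hx, hy] using hq q
      subst hdc
      rw [ZMod.val_add_one_of_add_one_ne_zero hd]
      have := (hstep i).2
      omega

/-- After removing the vertices of `V_q` from `D^M`, there is no directed path from
`s_i` to `t_i` for any `i`. -/
theorem stmt0 (k r R : ℕ) (hk : 1 ≤ k) (hr : 2 ≤ r) (hR : 1 ≤ R) (q : Fin R) (i : Fin k) :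
    ¬ ∃ p : List (MV k r R),
        List.Chain mvEdge (MV.s i) (p ++ [MV.t i]) ∧ ∀ z ∈ p, z ∉ mvCut q := by
  rintro ⟨p, h, hp⟩
  have : NeZero r := ⟨by omega⟩
  replace h : List.IsChain mvEdge (MV.s i :: (p ++ [MV.t i])) := h
  cases p with
  | nil => simp [mvEdge] at h
  | cons z p =>
    rw [List.cons_append, List.isChain_cons_cons] at h
    obtain ⟨hz, h⟩ := h
    cases z with
    | s j => exact hz
    | t j => exact hz
    | v α x =>
      obtain ⟨c, hx, hc⟩ := v_notMem_mvCut_iff.1 (hp _ List.mem_cons_self)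
      have hα : (α i).val = 0 := hz
      refine not_isChain_of_lt_val p (fun w hw => hp w (List.mem_cons_of_mem _ hw)) hx ?_ h
      rw [hα]
      exact ZMod.val_pos.2 hc
end

section
/- Let 0 < ε < 1, let (V_1, μ_1), …, (V_z, μ_z) be finite probability spaces, and for each 1 ≤ j < z let E_j ⊆ V_j × V_{j+1} be a relation such that for all S ⊆ V_j and T ⊆ V_{j+1} with μ_j(S) ≥ ε/3 and μ_{j+1}(T) ≥ ε/3 there exist x ∈ S and y ∈ T with (x,y) ∈ E_j. Let C_j ⊆ V_j satisfy μ_j(C_j) ≤ 1 − ε for every j. Define S_1 = V_1 ∖ C_1 and, for 1 ≤ j < z, S_{j+1} = {y ∈ V_{j+1} ∖ C_{j+1} : there exists x ∈ S_j with (x,y) ∈ E_j}. Then μ_z(S_z) ≥ ε/3; in particular there exists a sequence x_1,…,x_z with x_j ∈ V_j ∖ C_j for all j and (x_j, x_{j+1}) ∈ E_j for all 1 ≤ j < z. -/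
open Classical in
/-- The layered reachability sets: `layerS E C 0 = V 0 \ C 0`, and
`layerS E C (j+1) = {y ∈ V (j+1) \ C (j+1) : ∃ x ∈ layerS E C j, E j x y}`. -/
noncomputable def layerS {V : ℕ → Type} [∀ j, Fintype (V j)]
    (E : ∀ j, V j → V (j + 1) → Prop) (C : ∀ j, Finset (V j)) :
    (j : ℕ) → Finset (V j)
  | 0 => Finset.univ.filter fun x => x ∉ C 0
  | (j + 1) => Finset.univ.filter fun y =>
      y ∉ C (j + 1) ∧ ∃ x ∈ layerS E C j, E j x y

section LayeredReachability

variable {V : ℕ → Type} [∀ j, Fintype (V j)]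
  {E : ∀ j, V j → V (j + 1) → Prop} {C : ∀ j, Finset (V j)}

theorem mem_layerS_zero {x : V 0} : x ∈ layerS E C 0 ↔ x ∉ C 0 := by
  simp [layerS]

theorem mem_layerS_succ {j : ℕ} {y : V (j + 1)} :
    y ∈ layerS E C (j + 1) ↔ y ∉ C (j + 1) ∧ ∃ x ∈ layerS E C j, E j x y := by
  simp [layerS]

/-- One induction step of layered reachability: the uncut points have mass at least `ε`, so if
fewer than `ε / 3` of them were reachable, the unreachable ones would have mass at least `ε / 3`
and be joined to the previous layer. -/
theorem le_sum_layerS_succ {w : ∀ j, V j → ℝ} {ε : ℝ} (hε : 0 ≤ ε) {j : ℕ}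
    (hw : ∑ y, w (j + 1) y = 1)
    (hE : ∀ S : Finset (V j), ∀ T : Finset (V (j + 1)),
      ε / 3 ≤ ∑ x ∈ S, w j x → ε / 3 ≤ ∑ y ∈ T, w (j + 1) y → ∃ x ∈ S, ∃ y ∈ T, E j x y)
    (hC : ∑ y ∈ C (j + 1), w (j + 1) y ≤ 1 - ε)
    (hS : ε / 3 ≤ ∑ x ∈ layerS E C j, w j x) :
    ε / 3 ≤ ∑ y ∈ layerS E C (j + 1), w (j + 1) y := by
  classical
  by_contra! hlt
  have hsub : layerS E C (j + 1) ⊆ (C (j + 1))ᶜ := fun y hy =>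
    Finset.mem_compl.2 (mem_layerS_succ.1 hy).1
  have hcompl := Finset.sum_add_sum_compl (C (j + 1)) (w (j + 1))
  have hsdiff := Finset.sum_sdiff (f := w (j + 1)) hsub
  obtain ⟨x, hx, y, hy, hxy⟩ :=
    hE _ ((C (j + 1))ᶜ \ layerS E C (j + 1)) hS (by linarith)
  rw [Finset.mem_sdiff, Finset.mem_compl] at hy
  exact hy.2 (mem_layerS_succ.2 ⟨hy.1, x, hx, hxy⟩)

/-- Every point of `layerS E C j` is the end of a path through uncut points. -/
theorem exists_path_of_mem_layerS [∀ j, Nonempty (V j)] {j : ℕ} {y : V j}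
    (hy : y ∈ layerS E C j) :
    ∃ f : ∀ i, V i, f j = y ∧ (∀ i ≤ j, f i ∉ C i) ∧ ∀ i < j, E i (f i) (f (i + 1)) := by
  induction j with
  | zero =>
    refine ⟨Function.update (fun i => Classical.arbitrary (V i)) 0 y, by simp, ?_, by simp⟩
    intro i hi
    obtain rfl : i = 0 := by omega
    simpa using mem_layerS_zero.1 hy
  | succ j ih =>
    obtain ⟨hyC, x, hx, hxy⟩ := mem_layerS_succ.1 hy
    obtain ⟨f, rfl, hfC, hfE⟩ := ih hx
    refine ⟨Function.update f (j + 1) y, by simp, fun i hi => ?_, fun i hi => ?_⟩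
    · rcases hi.eq_or_lt with rfl | hi
      · simpa using hyC
      · rw [Function.update_of_ne hi.ne]
        exact hfC i (by omega)
    · rw [Function.update_of_ne hi.ne]
      rcases (Nat.lt_succ_iff.1 hi).eq_or_lt with rfl | hi
      · simpa using hxy
      · rw [Function.update_of_ne (by omega)]
        exact hfE i hi

end LayeredReachability

/-- Layered reachability induction: given finite probability spaces `(V j, w j)` for the layers
`0,…,z-1`, cross-intersecting relations `E j ⊆ V j × V (j+1)` (any two sets of measure `≥ ε/3`
in consecutive layers are joined by an edge), and cut sets `C j` of measure `≤ 1 - ε`, the set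
of points of the last layer reachable from the uncut part of layer `0` through uncut points has
measure `≥ ε/3`; in particular there is a sequence crossing all layers through uncut points. -/
theorem stmt1 (z : ℕ) (hz : 1 ≤ z) (ε : ℝ) (hε0 : 0 < ε) (hε1 : ε < 1)
    (V : ℕ → Type) [∀ j, Fintype (V j)]
    (w : ∀ j, V j → ℝ) (hw0 : ∀ j x, 0 ≤ w j x) (hw1 : ∀ j, ∑ x, w j x = 1)
    (E : ∀ j, V j → V (j + 1) → Prop)
    (hE : ∀ j, j + 1 < z → ∀ S : Finset (V j), ∀ T : Finset (V (j + 1)),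
      ε / 3 ≤ ∑ x ∈ S, w j x → ε / 3 ≤ ∑ y ∈ T, w (j + 1) y →
        ∃ x ∈ S, ∃ y ∈ T, E j x y)
    (C : ∀ j, Finset (V j)) (hC : ∀ j, j < z → ∑ x ∈ C j, w j x ≤ 1 - ε) :
    ε / 3 ≤ ∑ x ∈ layerS E C (z - 1), w (z - 1) x ∧
      ∃ f : ∀ j, V j, (∀ j, j < z → f j ∉ C j) ∧
        ∀ j, j + 1 < z → E j (f j) (f (j + 1)) := by
  have hmass : ∀ j, j < z → ε / 3 ≤ ∑ x ∈ layerS E C j, w j x := by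
    intro j
    induction j with
    | zero =>
      intro hj
      classical
      have hS : layerS E C 0 = (C 0)ᶜ := by
        ext x
        rw [mem_layerS_zero, Finset.mem_compl]
      have hcompl := Finset.sum_add_sum_compl (C 0) (w 0)
      have h1 := hw1 0
      have hC0 := hC 0 hj
      rw [hS]
      linarith
    | succ j ih =>
      exact fun hj => le_sum_layerS_succ hε0.le (hw1 (j + 1)) (hE j hj) (hC (j + 1) hj)
        (ih (by omega))
  have hlast := hmass (z - 1) (by omega)
  refine ⟨hlast, ?_⟩
  have : ∀ j, Nonempty (V j) := fun j => by
    by_contra h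
    rw [not_nonempty_iff] at h
    simpa using hw1 j
  obtain ⟨y, hy, -⟩ := Finset.exists_ne_zero_of_sum_ne_zero
    (ne_of_gt (lt_of_lt_of_le (by positivity) hlast))
  obtain ⟨f, -, hfC, hfE⟩ := exists_path_of_mem_layerS hy
  exact ⟨f, fun j hj => hfC j (by omega), fun j hj => hfE j (by omega)⟩
end

section
/- For every q ∈ {1,…,R}, let E_q be the set of short edges {v^i_x, v^{i+1}_y} of D^E such that y_q ≠ x_q + 1 (mod r) or (x_q, y_q) = (0, 1). Then in the graph D^E with the edges E_q removed, every path from s to t has total length at least a·(b − r + 1). -/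
/-- Vertices of the Short-Path-Edge-Cut dictatorship test `D^E`:
`s`, `t`, and `v^i_x` for `0 ≤ i ≤ b` and `x ∈ (ZMod r)^R`
(indices `i > b` are inert: no edge ever touches them). -/
inductive EV (r R : ℕ) where
  | s | t
  | v (i : ℕ) (x : Fin R → ZMod r)

/-- The dictator cut condition on a short edge `{v^i_x, v^{i+1}_y}`:
`y_q ≠ x_q + 1 (mod r)` or `(x_q, y_q) = (0, 1)`. -/
def ecut {r R : ℕ} (q : Fin R) (x y : Fin R → ZMod r) : Prop :=
  y q ≠ x q + 1 ∨ (x q = 0 ∧ y q = 1)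

/-- Adjacency-with-length of `D^E` after the edges of `E_q` have been removed:
`eAdj a b q u v n` says there is a remaining edge between `u` and `v` of length `n`.
Edges `{s, v^0_x}` and `{v^b_x, t}` have length `1`; long edges `{v^i_x, v^{i+1}_x}`
have length `a`; a short edge `{v^i_x, v^{i+1}_y}` (length `1`) remains iff it is not cut. -/
def eAdj (a b : ℕ) {r R : ℕ} (q : Fin R) : EV r R → EV r R → ℕ → Prop
  | .s, .v i _, n => i = 0 ∧ n = 1
  | .v i _, .t, n => i = b ∧ n = 1
  | .v i x, .v j y, n => j = i + 1 ∧ i < b ∧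
      ((y = x ∧ n = a) ∨ (n = 1 ∧ ¬ ecut q x y))
  | _, _, _ => False

/-- The potential of a vertex: `i - (x_q - 1).val` on `v^i_x`, clamped to `[0, b - r + 1]`.
It is constant along every remaining edge that is not long. -/
def epot (b : ℕ) {r R : ℕ} (q : Fin R) : EV r R → ℤ
  | .s => 0
  | .t => max 0 ((b : ℤ) - r + 1)
  | .v i x => max 0 (min ((i : ℤ) - ((x q - 1).val : ℤ)) ((b : ℤ) - r + 1))

/-- A short edge that is not cut raises the representative of `x_q - 1` in `{0, …, r - 1}` by one. -/
theorem val_sub_one_of_not_ecut {r R : ℕ} (hr : 2 ≤ r) {q : Fin R} {x y : Fin R → ZMod r}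
    (h : ¬ ecut q x y) : (y q - 1).val = (x q - 1).val + 1 := by
  have : Fact (1 < r) := ⟨hr⟩
  have : NeZero r := ⟨by omega⟩
  simp only [ecut, not_or, not_not, not_and] at h
  obtain ⟨hy, h0⟩ := h
  have hx : x q ≠ 0 := fun hx => h0 hx (by rw [hy, hx, zero_add])
  have hpos : 1 ≤ (x q).val := Nat.one_le_iff_ne_zero.mpr ((ZMod.val_ne_zero _).mpr hx)
  rw [hy, add_sub_cancel_right, ZMod.val_sub (by rwa [ZMod.val_one]), ZMod.val_one]
  omega

/-- Along a remaining edge the potential changes by at most the length divided by `a`. -/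
theorem mul_abs_epot_sub_le {a b r R : ℕ} (hr : 2 ≤ r) {q : Fin R} {u w : EV r R} {n : ℕ}
    (h : eAdj a b q u w n) : (a : ℤ) * |epot b q w - epot b q u| ≤ n := by
  have : NeZero r := ⟨by omega⟩
  have of_eq (h' : epot b q w = epot b q u) : (a : ℤ) * |epot b q w - epot b q u| ≤ n := by
    simp [h']
  rcases u with _ | _ | ⟨i, x⟩ <;> rcases w with _ | _ | ⟨j, y⟩ <;> simp only [eAdj] at h
  · apply of_eq
    simp only [epot]
    omega
  · apply of_eq
    have := ZMod.val_lt (x q - 1)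
    simp only [epot]
    omega
  · obtain ⟨rfl, -, ⟨rfl, rfl⟩ | ⟨-, hc⟩⟩ := h
    · refine mul_le_of_le_one_right (by positivity) (abs_le.mpr ?_)
      simp only [epot]
      omega
    · apply of_eq
      have := val_sub_one_of_not_ecut hr hc
      simp only [epot]
      omega

/-- After removing the dictator cut `E_q` from `D^E`, every path from `s` to `t`
has total length at least `a·(b - r + 1)`. -/
theorem stmt2 (a b r R : ℕ) (ha : 1 ≤ a) (hb : 1 ≤ b) (hr : 2 ≤ r) (hR : 1 ≤ R)
    (q : Fin R) (n : ℕ) (p : Fin (n + 1) → EV r R) (ℓ : Fin n → ℕ)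
    (hs : p 0 = EV.s) (ht : p (Fin.last n) = EV.t)
    (hadj : ∀ j : Fin n, eAdj a b q (p j.castSucc) (p j.succ) (ℓ j) ∨
      eAdj a b q (p j.succ) (p j.castSucc) (ℓ j)) :
    (a : ℤ) * ((b : ℤ) - (r : ℤ) + 1) ≤ ∑ j, (ℓ j : ℤ) := by
  have step (j : Fin n) : (a : ℤ) * (epot b q (p j.succ) - epot b q (p j.castSucc)) ≤ ℓ j := by
    refine (mul_le_mul_of_nonneg_left (le_abs_self _) (by positivity)).trans ?_
    rcases hadj j with h | h
    · exact mul_abs_epot_sub_le hr h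
    · rw [abs_sub_comm]
      exact mul_abs_epot_sub_le hr h
  have telescope : ∑ j : Fin n, (epot b q (p j.succ) - epot b q (p j.castSucc)) =
      epot b q (p (Fin.last n)) - epot b q (p 0) := by
    have h₀ := Fin.sum_univ_succ fun j => epot b q (p j)
    have h₁ := Fin.sum_univ_castSucc fun j => epot b q (p j)
    rw [Finset.sum_sub_distrib]
    linarith
  calc (a : ℤ) * ((b : ℤ) - r + 1)
      ≤ a * (epot b q (p (Fin.last n)) - epot b q (p 0)) := by
        rw [hs, ht]
        simp only [epot, sub_zero]
        gcongr
        exact le_max_right _ _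
    _ = ∑ j : Fin n, (a : ℤ) * (epot b q (p j.succ) - epot b q (p j.castSucc)) := by
        rw [← telescope, Finset.mul_sum]
    _ ≤ ∑ j, (ℓ j : ℤ) := Finset.sum_le_sum fun j _ => step j
end

section
/- Let r ≥ 2 and z ≥ 1, let y_1, …, y_z ∈ ZMod r, and let ε_1, …, ε_{z−1} ∈ {−1, 0, +1} be such that y_{j+1} = y_j + ε_j for all j, such that ε_j = +1 implies y_j ≠ 0, and ε_j = −1 implies y_{j+1} ≠ 0. Then #{j : ε_j = +1} − #{j : ε_j = −1} ≤ r − 1. -/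
/-- Away from zero, subtracting one in `ZMod r` lowers the representative by exactly one. -/
theorem ZMod.val_sub_one_add_one_of_ne_zero {r : ℕ} [Fact (1 < r)] {a : ZMod r} (ha : a ≠ 0) :
    (a - 1).val + 1 = a.val := by
  have : NeZero r := ⟨by have := Fact.out (p := 1 < r); omega⟩
  have hpos : 1 ≤ a.val := ZMod.val_pos.mpr ha
  rw [ZMod.val_sub (by rwa [ZMod.val_one]), ZMod.val_one, Nat.sub_add_cancel hpos]

theorem Fin.sum_succ_sub_castSucc {n : ℕ} (f : Fin (n + 1) → ℤ) :
    ∑ j : Fin n, (f j.succ - f j.castSucc) = f (Fin.last n) - f 0 := by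
  rw [Finset.sum_sub_distrib]
  linarith [Fin.sum_univ_succ f, Fin.sum_univ_castSucc f]

/-- Winding-number bound: if `y_1, …, y_{n+1} ∈ ZMod r` evolve by steps
`ε_j ∈ {-1, 0, +1}` (`y_{j+1} = y_j + ε_j`), a `+1` step never starts at `0`,
and a `-1` step never ends at `0`, then
`#{j : ε_j = +1} - #{j : ε_j = -1} ≤ r - 1`. -/
theorem stmt3 (r : ℕ) (hr : 2 ≤ r) (n : ℕ) (y : Fin (n + 1) → ZMod r)
    (ε : Fin n → ℤ) (hε : ∀ j, ε j = -1 ∨ ε j = 0 ∨ ε j = 1)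
    (hstep : ∀ j : Fin n, y j.succ = y j.castSucc + ((ε j : ℤ) : ZMod r))
    (hup : ∀ j : Fin n, ε j = 1 → y j.castSucc ≠ 0)
    (hdn : ∀ j : Fin n, ε j = -1 → y j.succ ≠ 0) :
    ((Finset.univ.filter fun j => ε j = 1).card : ℤ)
      - ((Finset.univ.filter fun j => ε j = -1).card : ℤ) ≤ (r : ℤ) - 1 := by
  have : Fact (1 < r) := ⟨hr⟩
  have : NeZero r := ⟨by omega⟩
  have hlift : ∀ j : Fin n,
      (((y j.succ - 1).val : ℤ) - ((y j.castSucc - 1).val : ℤ)) = ε j := by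
    intro j
    have hs := hstep j
    rcases hε j with h | h | h
    · have hv := ZMod.val_sub_one_add_one_of_ne_zero (hdn j h)
      have hc : y j.castSucc - 1 = y j.succ := by
        rw [hs, h]
        push_cast
        ring
      rw [hc, h]
      omega
    · rw [h, Int.cast_zero, add_zero] at hs
      rw [hs, h, sub_self]
    · have hv := ZMod.val_sub_one_add_one_of_ne_zero (hup j h)
      rw [hs, h, Int.cast_one, add_sub_cancel_right]
      omega
  have hcount : ((Finset.univ.filter fun j => ε j = 1).card : ℤ)
      - ((Finset.univ.filter fun j => ε j = -1).card : ℤ) = ∑ j, ε j := by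
    rw [Finset.card_filter, Finset.card_filter]
    push_cast
    rw [← Finset.sum_sub_distrib]
    refine Finset.sum_congr rfl fun j _ => ?_
    rcases hε j with h | h | h <;> simp [h]
  have htel := Fin.sum_succ_sub_castSucc fun i => ((y i - 1).val : ℤ)
  simp only [hlift] at htel
  rw [hcount, htel]
  have := ZMod.val_lt (y (Fin.last n) - 1)
  omega
end

section
/- For every q ∈ {1,…,R}, after removing from D^V the vertex set V_q = {v^i_x : 0 ≤ i ≤ b, x_q = * or x_q = 0}, every path from s to t has total length at least a·(b − r + 2). -/
/-- Vertices of the Short-Path-Vertex-Cut dictatorship test `D^V`: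
`s`, `t`, and `v^i_x` for `0 ≤ i ≤ b` and `x ∈ Ω^R` where `Ω = {0,…,r-1,*}` is encoded
by `Option (ZMod r)` with `none = *` (indices `i > b` are inert: no edge touches them). -/
inductive VV (r R : ℕ) where
  | s | t
  | v (i : ℕ) (x : Fin R → Option (ZMod r))

/-- `x, y ∈ Ω^R` are compatible if for every `j`, either `x_j, y_j ∈ {0,…,r-1}` and
`y_j = x_j + 1 (mod r)`, or `y_j = *`, or `x_j = *`. -/
def vcomp {r R : ℕ} (x y : Fin R → Option (ZMod r)) : Prop :=
  ∀ j, (∃ c : ZMod r, x j = some c ∧ y j = some (c + 1)) ∨ y j = none ∨ x j = none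

/-- Adjacency-with-length of `D^V`: `{s, v^i_x}` has length `a·i + 1`, `{v^i_x, t}` has
length `(b-i)·a + 1`, short edges `{v^i_x, v^{i+1}_y}` (compatible `x, y`) have length `1`,
and long edges `{v^i_x, v^j_y}` for `i + 1 < j ≤ b` (compatible `x, y`) have length `(j-i)·a`. -/
def vAdj (a b : ℕ) {r R : ℕ} : VV r R → VV r R → ℕ → Prop
  | .s, .v i _, n => i ≤ b ∧ n = a * i + 1
  | .v i _, .t, n => i ≤ b ∧ n = (b - i) * a + 1
  | .v i x, .v j y, n =>
      j ≤ b ∧ vcomp x y ∧ ((j = i + 1 ∧ n = 1) ∨ (i + 1 < j ∧ n = (j - i) * a))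
  | _, _, _ => False

/-- The dictator cut `V_q = {v^i_x : x_q = * or x_q = 0}`. -/
def vCut {r R : ℕ} (q : Fin R) : Set (VV r R) :=
  {z | ∃ i x, z = VV.v i x ∧ (x q = none ∨ x q = some 0)}

/-- The level of `z`, shifted by its `q`-th coordinate (taken in `{0,…,r-1}`) and scaled by `a`,
clamped to `[0, M]`; the vertices `s` and `t` get the two extreme values. -/
def vPot (a : ℕ) {r R : ℕ} (q : Fin R) (M : ℤ) : VV r R → ℤ
  | .s => 0
  | .t => M
  | .v i x => max 0 (min M (a * ((i : ℤ) - ((x q).getD 0).val + 1)))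

/-- A vertex `v^i_x` outside the dictator cut has `x_q ∈ {1,…,r-1}`. -/
theorem exists_val_of_notMem_vCut {r R : ℕ} [NeZero r] {q : Fin R} {i : ℕ}
    {x : Fin R → Option (ZMod r)} (h : VV.v i x ∉ vCut q) :
    ∃ c : ZMod r, x q = some c ∧ 1 ≤ c.val ∧ c.val < r := by
  rcases hx : x q with _ | c
  · exact absurd ⟨i, x, rfl, .inl hx⟩ h
  · refine ⟨c, rfl, Nat.one_le_iff_ne_zero.2 fun h0 => h ⟨i, x, rfl, .inr ?_⟩, c.val_lt⟩
    rw [hx, (ZMod.val_eq_zero c).1 h0]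

theorem ZMod.val_add_one_of_one_le_val {r : ℕ} (hr : 2 ≤ r) {c : ZMod r} (hc : 1 ≤ (c + 1).val) :
    (c + 1).val = c.val + 1 := by
  have : NeZero r := ⟨by omega⟩
  have : Fact (1 < r) := ⟨hr⟩
  have hlt := c.val_lt
  rw [ZMod.val_add, ZMod.val_one] at hc ⊢
  rcases Nat.lt_or_ge (c.val + 1) r with h | h
  · exact Nat.mod_eq_of_lt h
  · rw [show c.val + 1 = r by omega, Nat.mod_self] at hc
    omega

/-- Outside the dictator cut, the potential changes along an edge by at most its length. -/
theorem abs_vPot_sub_le_of_vAdj {a b r R : ℕ} (hr : 2 ≤ r) {q : Fin R} {M : ℤ} (hM : 0 ≤ M)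
    (hMb : M = max 0 (a * ((b : ℤ) - r + 2))) {u w : VV r R} (hu : u ∉ vCut q) (hw : w ∉ vCut q)
    {n : ℕ} (h : vAdj a b u w n) : |vPot a q M w - vPot a q M u| ≤ n := by
  have : NeZero r := ⟨by omega⟩
  have ha : (0 : ℤ) ≤ a := a.cast_nonneg
  match u, w, h with
  | .s, .v i x, ⟨_, hn⟩ =>
    obtain ⟨c, hc, hc1, _⟩ := exists_val_of_notMem_vCut hw
    have hle : (a : ℤ) * (i - c.val + 1) ≤ a * i := by gcongr; omega
    simp only [vPot, hc, Option.getD_some, hn]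
    push_cast
    rw [abs_le]
    have : (0 : ℤ) ≤ a * i := by positivity
    omega
  | .v i x, .t, ⟨hi, hn⟩ =>
    obtain ⟨c, hc, _, hcr⟩ := exists_val_of_notMem_vCut hu
    have hle : (a : ℤ) * (b - r + 2) ≤ a * (i - c.val + 1) + (b - i) * a := by
      rw [mul_comm _ (a : ℤ), ← mul_add]
      exact mul_le_mul_of_nonneg_left (by omega) ha
    have : (0 : ℤ) ≤ (b - i) * a := mul_nonneg (by omega) ha
    simp only [vPot, hc, Option.getD_some, hn]
    push_cast [hi]
    rw [abs_le]
    omega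
  | .v i x, .v j y, ⟨_, hxy, hn⟩ =>
    obtain ⟨c, hc, _, _⟩ := exists_val_of_notMem_vCut hu
    obtain ⟨d, hd, hd1, _⟩ := exists_val_of_notMem_vCut hw
    have hdc : d.val = c.val + 1 := by
      rcases hxy q with ⟨e, he, he'⟩ | h | h
      · obtain rfl : c = e := by simpa [hc] using he
        obtain rfl : d = c + 1 := by simpa [hd] using he'
        exact ZMod.val_add_one_of_one_le_val hr hd1
      · simp [hd] at h
      · simp [hc] at h
    have hraw : (a : ℤ) * (i - c.val + 1) ≤ a * (j - d.val + 1) ∧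
        (a : ℤ) * (j - d.val + 1) ≤ a * (i - c.val + 1) + n := by
      rcases hn with ⟨rfl, rfl⟩ | ⟨hij, rfl⟩
      · simp [hdc]
      · refine ⟨by gcongr 1; omega, ?_⟩
        rw [Nat.cast_mul, Nat.cast_sub (by omega), mul_comm _ (a : ℤ), ← mul_add]
        exact mul_le_mul_of_nonneg_left (by omega) ha
    simp only [vPot, hc, hd, Option.getD_some]
    rw [abs_le]
    omega

/-- After removing the vertices of `V_q` from `D^V`, every path from `s` to `t`
has total length at least `a·(b - r + 2)`. -/
theorem stmt6 (a b r R : ℕ) (ha : 1 ≤ a) (hb : 1 ≤ b) (hr : 2 ≤ r) (hR : 1 ≤ R)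
    (q : Fin R) (n : ℕ) (p : Fin (n + 1) → VV r R) (ℓ : Fin n → ℕ)
    (hs : p 0 = VV.s) (ht : p (Fin.last n) = VV.t)
    (hadj : ∀ j : Fin n, vAdj a b (p j.castSucc) (p j.succ) (ℓ j) ∨
      vAdj a b (p j.succ) (p j.castSucc) (ℓ j))
    (havoid : ∀ j, p j ∉ vCut q) :
    (a : ℤ) * ((b : ℤ) - (r : ℤ) + 2) ≤ ∑ j, (ℓ j : ℤ) := by
  set M : ℤ := max 0 (a * ((b : ℤ) - r + 2)) with hMb
  have hM : 0 ≤ M := le_max_left _ _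
  calc (a : ℤ) * ((b : ℤ) - r + 2) ≤ M := le_max_right _ _
    _ = vPot a q M (p (Fin.last n)) - vPot a q M (p 0) := by simp [hs, ht, vPot]
    _ = ∑ j : Fin n, (vPot a q M (p j.succ) - vPot a q M (p j.castSucc)) :=
      (Fin.sum_succ_sub_castSucc fun j => vPot a q M (p j)).symm
    _ ≤ ∑ j, (ℓ j : ℤ) := Finset.sum_le_sum fun j _ => by
      rcases hadj j with h | h
      · exact (le_abs_self _).trans
          (abs_vPot_sub_le_of_vAdj hr hM hMb (havoid _) (havoid _) h)
      · rw [← neg_sub]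
        exact (neg_le_abs _).trans
          (abs_vPot_sub_le_of_vAdj hr hM hMb (havoid _) (havoid _) h)
end

section
/- Let 0 < ε < 1 and let μ denote the product measure on Ω^R where μ(*) = ε and μ(x) = (1−ε)/r for x ∈ {0,…,r−1}. Let C be a set of vertices v^i_x of D^V; call layer i blocked if μ({x : v^i_x ∈ C}) ≥ 1 − ε, let k' be the number of blocked layers, and assume k' ≤ b (at least one layer is unblocked). Suppose that for all S, T ⊆ Ω^R with μ(S) ≥ ε/3 and μ(T) ≥ ε/3 there exist x ∈ S and y ∈ T that are compatible. Then there is a path from s to t in D^V avoiding C of total length at most 2 + (b − 2k') + 2·a·k'. -/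
open Classical

/-- The product measure `μ` on `Ω^R` with `μ(*) = ε` and `μ(c) = (1-ε)/r` for `c ≠ *`. -/
noncomputable def vμ (r R : ℕ) (ε : ℝ) (x : Fin R → Option (ZMod r)) : ℝ :=
  ∏ j, if x j = none then ε else (1 - ε) / r

/-- There is a path from `w` to `t` of total length at most `L` avoiding the cut `C`. -/
def HasCutFreePath (a b : ℕ) {r R : ℕ} (C : ℕ → Finset (Fin R → Option (ZMod r)))
    (w : VV r R) (L : ℕ) : Prop :=
  ∃ (n : ℕ) (p : Fin (n + 1) → VV r R) (ℓ : Fin n → ℕ),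
    p 0 = w ∧ p (Fin.last n) = VV.t ∧
    (∀ j : Fin n, vAdj a b (p j.castSucc) (p j.succ) (ℓ j) ∨
      vAdj a b (p j.succ) (p j.castSucc) (ℓ j)) ∧
    (∀ (j : Fin (n + 1)) (i : ℕ) (x : Fin R → Option (ZMod r)),
      p j = VV.v i x → x ∉ C i) ∧
    ∑ j, ℓ j ≤ L

theorem HasCutFreePath.target (a b : ℕ) {r R : ℕ} (C : ℕ → Finset (Fin R → Option (ZMod r))) :
    HasCutFreePath a b C VV.t 0 :=
  ⟨0, fun _ => VV.t, fun _ => 0, rfl, rfl, fun j => j.elim0, fun _ _ _ h => by simp at h, by simp⟩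

theorem HasCutFreePath.cons {a b r R : ℕ} {C : ℕ → Finset (Fin R → Option (ZMod r))}
    {u w : VV r R} {d L M : ℕ} (hw : HasCutFreePath a b C w L) (huw : vAdj a b u w d)
    (hu : ∀ i x, u = VV.v i x → x ∉ C i) (hM : d + L ≤ M) : HasCutFreePath a b C u M := by
  obtain ⟨n, p, ℓ, h0, ht, hE, hC, hL⟩ := hw
  refine ⟨n + 1, Fin.cons u p, Fin.cons d ℓ, rfl, ?_, ?_, ?_, ?_⟩
  · rw [← Fin.succ_last, Fin.cons_succ, ht]
  · refine Fin.cases ?_ fun j => ?_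
    · left
      simpa [h0] using huw
    · simpa [← Fin.succ_castSucc] using hE j
  · refine Fin.cases ?_ fun j => ?_
    · simpa using hu
    · simpa using hC j
  · rw [Fin.sum_univ_succ]
    simp only [Fin.cons_zero, Fin.cons_succ]
    omega

theorem sum_vμ (r R : ℕ) [NeZero r] (ε : ℝ) :
    ∑ x : Fin R → Option (ZMod r), vμ r R ε x = 1 := by
  have hr : (r : ℝ) ≠ 0 := Nat.cast_ne_zero.mpr (NeZero.ne r)
  have h := Finset.prod_univ_sum (fun _ : Fin R => (Finset.univ : Finset (Option (ZMod r))))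
    (fun _ y => if y = none then ε else (1 - ε) / r)
  rw [Fintype.piFinset_univ] at h
  unfold vμ
  rw [← h]
  refine Finset.prod_eq_one fun j _ => ?_
  rw [Fintype.sum_option]
  simp only [if_true, reduceCtorEq, if_false, Finset.sum_const, Finset.card_univ, ZMod.card,
    nsmul_eq_mul]
  field_simp
  ring

/-- The elements of `A` compatible with some element of a non-negligible set `T` form a
non-negligible set as soon as `A` has measure at least `ε`. -/
theorem le_sum_filter_vcomp {r R : ℕ} {ε : ℝ} (hε0 : 0 < ε)
    (hexp : ∀ S T : Finset (Fin R → Option (ZMod r)),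
      ε / 3 ≤ ∑ x ∈ S, vμ r R ε x → ε / 3 ≤ ∑ y ∈ T, vμ r R ε y →
        ∃ x ∈ S, ∃ y ∈ T, vcomp x y)
    {A T : Finset (Fin R → Option (ZMod r))} (hA : ε ≤ ∑ x ∈ A, vμ r R ε x)
    (hT : ε / 3 ≤ ∑ y ∈ T, vμ r R ε y) :
    ε / 3 ≤ ∑ x ∈ A with ∃ y ∈ T, vcomp x y, vμ r R ε x := by
  by_contra! h
  have hsplit := Finset.sum_filter_add_sum_filter_not A (fun x => ∃ y ∈ T, vcomp x y) (vμ r R ε)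
  obtain ⟨x, hx, y, hy, hxy⟩ :=
    hexp (A.filter fun x => ¬ ∃ y ∈ T, vcomp x y) T (by linarith) hT
  exact (Finset.mem_filter.mp hx).2 ⟨y, hy, hxy⟩

/-- One plus the total weight of the layers `i, …, b`, a layer weighing `2 * a - 1` if it is
blocked and `1` otherwise. -/
noncomputable def layerBudget (a b : ℕ) (B : ℕ → Prop) (i : ℕ) : ℕ :=
  1 + ∑ l ∈ Finset.Ico i (b + 1), if B l then 2 * a - 1 else 1

theorem layerBudget_eq_add {a b : ℕ} (B : ℕ → Prop) {i : ℕ} (hi : i ≤ b) :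
    layerBudget a b B i = (if B i then 2 * a - 1 else 1) + layerBudget a b B (i + 1) := by
  unfold layerBudget
  rw [Finset.sum_eq_sum_Ico_succ_bot (by omega)]
  omega

/-- Either all layers `i, …, b` are blocked, or the first unblocked layer `j ≥ i` has a
non-negligible set of vertices from which `t` is reached within the budget of the layers
above `j`. -/
theorem blocked_or_exists_reachable {a b r R : ℕ} (ha : 1 ≤ a) [NeZero r] {ε : ℝ}
    (hε0 : 0 < ε) (C : ℕ → Finset (Fin R → Option (ZMod r)))
    (hexp : ∀ S T : Finset (Fin R → Option (ZMod r)),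
      ε / 3 ≤ ∑ x ∈ S, vμ r R ε x → ε / 3 ≤ ∑ y ∈ T, vμ r R ε y →
        ∃ x ∈ S, ∃ y ∈ T, vcomp x y)
    {B : ℕ → Prop} (hB : ∀ i, B i ↔ 1 - ε ≤ ∑ x ∈ C i, vμ r R ε x)
    (d : ℕ) : ∀ i, i + d = b + 1 →
      ((∀ l, i ≤ l → l ≤ b → B l) ∧ layerBudget a b B i = 1 + (2 * a - 1) * d) ∨
      ∃ g, i + g ≤ b ∧
        layerBudget a b B i = (2 * a - 1) * g + 1 + layerBudget a b B (i + g + 1) ∧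
        ∃ T : Finset (Fin R → Option (ZMod r)), ε / 3 ≤ ∑ x ∈ T, vμ r R ε x ∧
          ∀ x ∈ T, x ∉ C (i + g) ∧
            HasCutFreePath a b C (VV.v (i + g) x) (layerBudget a b B (i + g + 1)) := by
  induction d with
  | zero =>
    intro i hi
    left
    refine ⟨fun l h1 h2 => by omega, ?_⟩
    obtain rfl : i = b + 1 := by omega
    simp [layerBudget]
  | succ d ih =>
    intro i hi
    have hib : i ≤ b := by omega
    have hbud := layerBudget_eq_add (a := a) B hib
    obtain ⟨c, rfl⟩ : ∃ c, a = c + 1 := ⟨a - 1, by omega⟩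
    have h2a : 2 * (c + 1) - 1 = 2 * c + 1 := by omega
    rw [h2a] at hbud ih ⊢
    by_cases hBi : B i
    · rw [if_pos hBi] at hbud
      rcases ih (i + 1) (by omega) with ⟨hall, hf⟩ | ⟨g, hg, hf, hT⟩
      · left
        refine ⟨fun l h1 h2 => ?_, by rw [hbud, hf]; ring⟩
        rcases h1.eq_or_lt with rfl | h
        · exact hBi
        · exact hall l h h2
      · right
        have hidx : i + 1 + g = i + (g + 1) := by omega
        rw [hidx] at hg hf hT
        exact ⟨g + 1, hg, by rw [hbud, hf]; ring, hT⟩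
    · rw [if_neg hBi] at hbud
      right
      refine ⟨0, hib, by simpa using hbud, ?_⟩
      rw [Nat.add_zero]
      have hA : ε ≤ ∑ x ∈ (C i)ᶜ, vμ r R ε x := by
        have h1 := Finset.sum_add_sum_compl (C i) (vμ r R ε)
        rw [sum_vμ] at h1
        rw [hB, not_le] at hBi
        linarith
      have hv : ∀ x ∉ C i, ∀ k y, (VV.v i x : VV r R) = VV.v k y → y ∉ C k := by
        rintro x hx k y h
        cases h
        exact hx
      rcases ih (i + 1) (by omega) with ⟨-, hf⟩ | ⟨g, hg, hf, T, hT, hpath⟩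
      · refine ⟨(C i)ᶜ, by linarith, fun x hx => ?_⟩
        rw [Finset.mem_compl] at hx
        refine ⟨hx, (HasCutFreePath.target _ b C).cons ⟨hib, rfl⟩ (hv x hx) ?_⟩
        rw [hf, show b - i = d by omega]
        nlinarith [Nat.zero_le (c * d)]
      · refine ⟨_, le_sum_filter_vcomp hε0 hexp hA hT, fun x hx => ?_⟩
        obtain ⟨hxC, y, hy, hxy⟩ := Finset.mem_filter.mp hx
        rw [Finset.mem_compl] at hxC
        refine ⟨hxC, ?_⟩
        rcases Nat.eq_zero_or_pos g with rfl | hgpos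
        · exact (hpath y hy).2.cons ⟨hg, hxy, Or.inl ⟨rfl, rfl⟩⟩ (hv x hxC) (by omega)
        · refine (hpath y hy).2.cons ⟨hg, hxy, Or.inr ⟨by omega, rfl⟩⟩ (hv x hxC) ?_
          rw [hf, show i + 1 + g - i = g + 1 by omega]
          nlinarith [Nat.mul_le_mul_left c hgpos]

theorem layerBudget_zero {a : ℕ} (ha : 1 ≤ a) (b : ℕ) (B : ℕ → Prop) :
    (layerBudget a b B 0 : ℤ) = 2 + ((b : ℤ) - 2 * (((Finset.range (b + 1)).filter B).card : ℤ)) +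
      2 * (a : ℤ) * (((Finset.range (b + 1)).filter B).card : ℤ) := by
  have hcard := Finset.card_filter_add_card_filter_not (s := Finset.range (b + 1)) B
  rw [Finset.card_range] at hcard
  unfold layerBudget
  rw [← Finset.range_eq_Ico, Finset.sum_ite]
  simp only [Finset.sum_const, smul_eq_mul, mul_one]
  zify [show 1 ≤ 2 * a by omega] at hcard ⊢
  linear_combination hcard

/-- Soundness of the `D^V` dictatorship test: if `C` cuts, in each layer `i`, a set of
`μ`-measure given by `C i`, `k'` layers are blocked (`μ(C_i) ≥ 1 - ε`), `k' ≤ b`, and any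
two sets of measure `≥ ε/3` contain a compatible pair, then there is a path from `s` to
`t` avoiding the cut vertices of total length at most `2 + (b - 2k') + 2·a·k'`. -/
theorem stmt7 (a b r R : ℕ) (ha : 1 ≤ a) (hb : 1 ≤ b) (hr : 2 ≤ r) (hR : 1 ≤ R)
    (ε : ℝ) (hε0 : 0 < ε) (hε1 : ε < 1)
    (C : ℕ → Finset (Fin R → Option (ZMod r)))
    (k' : ℕ)
    (hk' : k' = ((Finset.range (b + 1)).filter
      fun i => 1 - ε ≤ ∑ x ∈ C i, vμ r R ε x).card)
    (hkb : k' ≤ b)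
    (hexp : ∀ S T : Finset (Fin R → Option (ZMod r)),
      ε / 3 ≤ ∑ x ∈ S, vμ r R ε x → ε / 3 ≤ ∑ y ∈ T, vμ r R ε y →
        ∃ x ∈ S, ∃ y ∈ T, vcomp x y) :
    ∃ (n : ℕ) (p : Fin (n + 1) → VV r R) (ℓ : Fin n → ℕ),
      p 0 = VV.s ∧ p (Fin.last n) = VV.t ∧
      (∀ j : Fin n, vAdj a b (p j.castSucc) (p j.succ) (ℓ j) ∨
        vAdj a b (p j.succ) (p j.castSucc) (ℓ j)) ∧
      (∀ (j : Fin (n + 1)) (i : ℕ) (x : Fin R → Option (ZMod r)),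
        p j = VV.v i x → x ∉ C i) ∧
      ∑ j, (ℓ j : ℤ) ≤ 2 + ((b : ℤ) - 2 * (k' : ℤ)) + 2 * (a : ℤ) * (k' : ℤ) := by
  have : NeZero r := ⟨by omega⟩
  set B : ℕ → Prop := fun i => 1 - ε ≤ ∑ x ∈ C i, vμ r R ε x
  have hbudget : (layerBudget a b B 0 : ℤ) =
      2 + ((b : ℤ) - 2 * (k' : ℤ)) + 2 * (a : ℤ) * (k' : ℤ) := by
    rw [layerBudget_zero ha, hk']
  suffices HasCutFreePath a b C VV.s (layerBudget a b B 0) by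
    obtain ⟨n, p, ℓ, h0, ht, hE, hC, hL⟩ := this
    exact ⟨n, p, ℓ, h0, ht, hE, hC, by rw [← hbudget]; exact_mod_cast hL⟩
  rcases blocked_or_exists_reachable (b := b) ha hε0 C hexp (B := B) (fun _ => Iff.rfl) (b + 1) 0
    (Nat.zero_add _) with ⟨hall, -⟩ | ⟨g, hg, hf, T, hT, hpath⟩
  · rw [Finset.filter_true_of_mem fun l hl => hall l l.zero_le
      (Nat.lt_succ_iff.mp (Finset.mem_range.mp hl)), Finset.card_range] at hk'
    omega
  · rw [Nat.zero_add] at hg hf hpath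
    obtain ⟨x, hx⟩ : T.Nonempty := by
      rw [Finset.nonempty_iff_ne_empty]
      rintro rfl
      rw [Finset.sum_empty] at hT
      linarith
    refine (hpath x hx).2.cons ⟨hg, rfl⟩ (fun _ _ h => nomatch h) ?_
    rw [hf]
    have : a * g ≤ (2 * a - 1) * g := Nat.mul_le_mul_right g (by omega)
    omega
end

section
/- In the fire process on D^F with dictator saving strategy V^1_q, …, V^b_q, the vertex t is never burnt: t ∉ Burn_i for every i ≥ 0. -/
/-- Vertices of the RMFC dictatorship test `D^F`: `s`, `t`, and `v^i_x` for `1 ≤ i ≤ b`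
and `x ∈ Ω^R`, where `Ω = {*, 1, …, B}` is encoded by `Option (Fin B)` with `none = *`
and `some c` standing for the value `c.val + 1 ∈ {1,…,B}`. -/
inductive FV (B R : ℕ) where
  | s | t
  | v (i : ℕ) (x : Fin R → Option (Fin B))

/-- `x, y ∈ Ω^R` are compatible if for every `j`, `y_j = x_j` or `y_j = *` or `x_j = *`. -/
def fcomp {B R : ℕ} (x y : Fin R → Option (Fin B)) : Prop :=
  ∀ j, y j = x j ∨ y j = none ∨ x j = none

/-- Edges of `D^F`: `{s, v^1_x}` for every `x`, `{v^b_x, t}` for every `x`, and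
`{v^i_x, v^{i+1}_y}` for `1 ≤ i < b` and compatible `x, y`. -/
def fAdj (b : ℕ) {B R : ℕ} : FV B R → FV B R → Prop
  | .s, .v i _ => i = 1
  | .v i _, .t => i = b
  | .v i x, .v j y => j = i + 1 ∧ 1 ≤ i ∧ j ≤ b ∧ fcomp x y
  | _, _ => False

/-- Neighbors in `D^F` of a set of vertices. -/
def fN (b : ℕ) {B R : ℕ} (A : Set (FV B R)) : Set (FV B R) :=
  {z | ∃ w ∈ A, fAdj b w z ∨ fAdj b z w}

/-- The threshold `B_i = (b!)²·H_i`, an integer: `B_i = Σ_{j=1}^i (b!·b!)/j`. -/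
def Bthr (b i : ℕ) : ℕ := ∑ j ∈ Finset.Icc 1 i, Nat.factorial b * Nat.factorial b / j

/-- `B = b!·Σ_{i=1}^b (b!/i)`. -/
def Bval (b : ℕ) : ℕ := Nat.factorial b * ∑ i ∈ Finset.Icc 1 b, Nat.factorial b / i

/-- The set `V^j_q = {v^j_x : x_q = * or B_{j-1}+1 ≤ x_q ≤ B_j}` saved on day `j`.
Since `some c` encodes the value `c.val + 1`, the condition `B_{j-1}+1 ≤ x_q ≤ B_j`
reads `B_{j-1} ≤ c.val < B_j`. -/
def fSavedDay (b : ℕ) {B R : ℕ} (q : Fin R) (j : ℕ) : Set (FV B R) :=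
  {z | ∃ x, z = FV.v j x ∧
    (x q = none ∨ ∃ c : Fin B, x q = some c ∧ Bthr b (j - 1) ≤ c.val ∧ c.val < Bthr b j)}

/-- All vertices saved by day `i`: `Saved_i = ∪_{1 ≤ j ≤ min(i,b)} V^j_q`. -/
def fSaved (b : ℕ) {B R : ℕ} (q : Fin R) (i : ℕ) : Set (FV B R) :=
  ⋃ j ∈ Finset.Icc 1 (min i b), fSavedDay b q j

/-- The fire process: `Burn_0 = {s}` and
`Burn_{i+1} = Burn_i ∪ (N(Burn_i) \ Saved_{i+1})`. -/
def fBurn (b : ℕ) {B R : ℕ} (q : Fin R) : ℕ → Set (FV B R)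
  | 0 => {FV.s}
  | (i + 1) => fBurn b q i ∪ (fN b (fBurn b q i) \ fSaved b q (i + 1))

theorem Bthr_self (b : ℕ) : Bthr b b = Bval b := by
  unfold Bthr Bval
  rw [Finset.mul_sum]
  refine Finset.sum_congr rfl fun j hj => ?_
  obtain ⟨h1, h2⟩ := Finset.mem_Icc.mp hj
  exact Nat.mul_div_assoc _ (Nat.dvd_factorial h1 h2)

theorem Bthr_mono (b : ℕ) : Monotone (Bthr b) := fun _ _ h =>
  Finset.sum_le_sum_of_subset (Finset.Icc_subset_Icc_right h)

/-- Vertices that can be burnt by day `i`: the source, and those in a layer `j ≤ i` whose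
`q`-th coordinate is a value exceeding the threshold of layer `j`. -/
def Burnable (b : ℕ) {B R : ℕ} (q : Fin R) (i : ℕ) : FV B R → Prop
  | .s => True
  | .t => False
  | .v j x => 1 ≤ j ∧ j ≤ i ∧ j ≤ b ∧ ∃ c : Fin B, x q = some c ∧ Bthr b j ≤ c.val

theorem Burnable.of_notMem_fSaved {b B R : ℕ} {q : Fin R} {i j : ℕ}
    {x : Fin R → Option (Fin B)} (h1 : 1 ≤ j) (hi : j ≤ i) (hb : j ≤ b)
    (hs : FV.v j x ∉ fSaved b q i) (hx : ∀ c, x q = some c → Bthr b (j - 1) ≤ c.val) :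
    Burnable b q i (FV.v j x) := by
  have hday : FV.v j x ∉ fSavedDay b q j := fun h =>
    hs (Set.mem_biUnion (Finset.mem_Icc.mpr ⟨h1, le_min hi hb⟩) h)
  refine ⟨h1, hi, hb, ?_⟩
  cases hc : x q with
  | none => exact absurd ⟨x, rfl, Or.inl hc⟩ hday
  | some c =>
    refine ⟨c, rfl, ?_⟩
    by_contra! hlt
    exact hday ⟨x, rfl, Or.inr ⟨c, hc, hx c hc, hlt⟩⟩

theorem burnable_of_mem_fBurn {b R : ℕ} (hb : 1 ≤ b) (q : Fin R) (i : ℕ) :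
    ∀ z ∈ fBurn (B := Bval b) b q i, Burnable b q i z := by
  induction i with
  | zero =>
    rintro z rfl
    trivial
  | succ i ih =>
    rintro z (hz | ⟨⟨w, hw, hadj⟩, hs⟩)
    · have h := ih z hz
      cases z with
      | s => trivial
      | t => exact h
      | v j x => exact ⟨h.1, h.2.1.trans i.le_succ, h.2.2⟩
    · have hw := ih w hw
      cases w with
      | t => exact hw.elim
      | s =>
        cases z with
        | s => trivial
        | t => simp [fAdj] at hadj
        | v j x =>
          obtain rfl : j = 1 := by simpa [fAdj] using hadj
          exact .of_notMem_fSaved le_rfl (by omega) hb hs fun c _ => by simp [Bthr]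
      | v k y =>
        obtain ⟨hk1, hki, hkb, c, hc, hck⟩ := hw
        cases z with
        | s => trivial
        | t =>
          obtain rfl : k = b := by simpa [fAdj] using hadj
          rw [Bthr_self] at hck
          exact absurd c.isLt hck.not_gt
        | v j x =>
          rcases hadj with ⟨rfl, -, hjb, hcomp⟩ | ⟨rfl, hj1, -, hcomp⟩
          · refine .of_notMem_fSaved (by omega) (by omega) hjb hs fun d hd => ?_
            have := hcomp q
            simp only [hc, hd, Option.some.injEq, reduceCtorEq, or_false] at this
            exact this ▸ hck
          · refine .of_notMem_fSaved hj1 (by omega) (by omega) hs fun d hd => ?_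
            have := hcomp q
            simp only [hc, hd, Option.some.injEq, reduceCtorEq, or_false] at this
            exact this ▸ (Bthr_mono b (by omega)).trans hck

/-- In the fire process on `D^F` (with `B = Bval b`) under the dictator saving strategy
`V^1_q, …, V^b_q`, the vertex `t` is never burnt. -/
theorem stmt8 (b R : ℕ) (hb : 1 ≤ b) (hR : 1 ≤ R) (q : Fin R) (i : ℕ) :
    FV.t ∉ fBurn (B := Bval b) b q i :=
  fun h => burnable_of_mem_fBurn hb q i _ h
end

section
/- Let X be a finite set, μ a probability measure on X, and E ⊆ X × X a relation such that for all S, T ⊆ X with μ(S) ≥ 1/3 and μ(T) ≥ 1/3 there exist x ∈ S and y ∈ T with (x, y) ∈ E. Let b ≥ 1, and for each day i ∈ {1,…,b} let C_i ⊆ {1,…,b} × X be a saved set whose weight Σ_{(l,x) ∈ C_i} l·μ({x}) is at most 1/3. Define S_1 = {x ∈ X : (1, x) ∉ C_1} and, for 1 ≤ i < b, S_{i+1} = {y ∈ X : (i+1, y) ∉ C_1 ∪ … ∪ C_{i+1} and there exists x ∈ S_i with (x, y) ∈ E}. Then μ(S_i) ≥ 1/3 for every 1 ≤ i ≤ b.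 -/
open Classical in
/-- The burnt sets of the RMFC soundness induction:
`S_1 = {x : (1,x) ∉ C_1}` and, for `1 ≤ i < b`,
`S_{i+1} = {y : (i+1, y) ∉ C_1 ∪ … ∪ C_{i+1} and ∃ x ∈ S_i, E x y}`. -/
noncomputable def rS {X : Type} [Fintype X] (E : X → X → Prop)
    (C : ℕ → Finset (ℕ × X)) : ℕ → Finset X
  | 0 => Finset.univ
  | 1 => Finset.univ.filter fun x => ((1 : ℕ), x) ∉ C 1
  | (i + 2) => Finset.univ.filter fun y =>
      (∀ m ∈ Finset.Icc 1 (i + 2), ((i + 2 : ℕ), y) ∉ C m) ∧ ∃ x ∈ rS E C (i + 1), E x y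

/-- If each of the sets `C 1, …, C i` has weight at most `1/3`, then together they cover at most
measure `1/3` of layer `i`, whose points `x` have weight `i * μ x`. -/
lemma sum_covered_layer_le {X : Type} [Fintype X] (μ : X → ℝ) (hμ0 : ∀ x, 0 ≤ μ x)
    (C : ℕ → Finset (ℕ × X)) (i : ℕ) (hi : 1 ≤ i)
    [DecidablePred fun y => ∃ m ∈ Finset.Icc 1 i, (i, y) ∈ C m]
    (hC : ∀ m ∈ Finset.Icc 1 i, ∑ p ∈ C m, (p.1 : ℝ) * μ p.2 ≤ 1 / 3) :
    ∑ y with ∃ m ∈ Finset.Icc 1 i, (i, y) ∈ C m, μ y ≤ 1 / 3 := by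
  classical
  have hi' : (0 : ℝ) < i := by exact_mod_cast hi
  have layer (m : ℕ) (hm : m ∈ Finset.Icc 1 i) :
      ∑ y, (if (i, y) ∈ C m then (i : ℝ) * μ y else 0) ≤ 1 / 3 := by
    refine le_trans ?_ (hC m hm)
    rw [← Finset.sum_filter]
    have himage : ∑ y with (i, y) ∈ C m, (i : ℝ) * μ y =
        ∑ p ∈ (Finset.univ.filter fun y => (i, y) ∈ C m).image (Prod.mk i),
          (p.1 : ℝ) * μ p.2 := by
      rw [Finset.sum_image (fun a _ b _ h => (Prod.mk.inj h).2)]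
    rw [himage]
    refine Finset.sum_le_sum_of_subset_of_nonneg ?_
      fun p _ _ => mul_nonneg (Nat.cast_nonneg _) (hμ0 _)
    intro p hp
    obtain ⟨y, hy, rfl⟩ := Finset.mem_image.1 hp
    exact (Finset.mem_filter.1 hy).2
  have union : (i : ℝ) * ∑ y with ∃ m ∈ Finset.Icc 1 i, (i, y) ∈ C m, μ y ≤
      ∑ m ∈ Finset.Icc 1 i, ∑ y, (if (i, y) ∈ C m then (i : ℝ) * μ y else 0) := by
    rw [Finset.sum_comm, Finset.mul_sum, Finset.sum_filter]
    refine Finset.sum_le_sum fun y _ => ?_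
    have hnonneg : ∀ m ∈ Finset.Icc 1 i, 0 ≤ if (i, y) ∈ C m then (i : ℝ) * μ y else 0 := by
      intro m _
      split_ifs
      · exact mul_nonneg hi'.le (hμ0 y)
      · exact le_rfl
    split_ifs with h
    · obtain ⟨m, hm, hy⟩ := h
      simpa only [if_pos hy] using Finset.single_le_sum hnonneg hm
    · exact Finset.sum_nonneg hnonneg
  have total := union.trans (Finset.sum_le_sum layer)
  simp only [Finset.sum_const, Nat.card_Icc, Nat.add_sub_cancel, nsmul_eq_mul] at total
  exact le_of_mul_le_mul_left total hi'

/-- RMFC soundness induction: `μ` is a probability measure on the finite set `X`, the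
relation `E` joins any two sets of measure `≥ 1/3`, and on each day `i ∈ {1,…,b}` a set
`C_i ⊆ {1,…,b} × X` of weight `Σ_{(l,x)∈C_i} l·μ(x) ≤ 1/3` is saved (a point `x` of
layer `l` has weight `l·μ(x)`).  Then the burnt sets satisfy `μ(S_i) ≥ 1/3` for all
`1 ≤ i ≤ b`. -/
theorem stmt9 {X : Type} [Fintype X] (μ : X → ℝ) (hμ0 : ∀ x, 0 ≤ μ x)
    (hμ1 : ∑ x, μ x = 1)
    (E : X → X → Prop)
    (hE : ∀ S T : Finset X, (1 : ℝ) / 3 ≤ ∑ x ∈ S, μ x → (1 : ℝ) / 3 ≤ ∑ y ∈ T, μ y →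
      ∃ x ∈ S, ∃ y ∈ T, E x y)
    (b : ℕ) (hb : 1 ≤ b) (C : ℕ → Finset (ℕ × X))
    (hC : ∀ i, 1 ≤ i → i ≤ b → ∑ p ∈ C i, (p.1 : ℝ) * μ p.2 ≤ 1 / 3) :
    ∀ i, 1 ≤ i → i ≤ b → (1 : ℝ) / 3 ≤ ∑ x ∈ rS E C i, μ x := by
  classical
  intro i hi
  induction i, hi using Nat.le_induction with
  | base =>
    intro _
    have hcov := sum_covered_layer_le μ hμ0 C 1 le_rfl fun m hm =>
      hC m (Finset.mem_Icc.1 hm).1 ((Finset.mem_Icc.1 hm).2.trans hb)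
    have hsplit := Finset.sum_filter_add_sum_filter_not Finset.univ
      (fun x => ((1 : ℕ), x) ∈ C 1) μ
    simp only [Finset.Icc_self, Finset.mem_singleton, exists_eq_left] at hcov
    simp only [rS]
    linarith
  | succ i hi ih =>
    intro hib
    obtain ⟨j, rfl⟩ : ∃ j, i = j + 1 := ⟨i - 1, by omega⟩
    have hS := ih (by omega)
    have hcov := sum_covered_layer_le μ hμ0 C (j + 2) (by omega) fun m hm =>
      hC m (Finset.mem_Icc.1 hm).1 ((Finset.mem_Icc.1 hm).2.trans hib)
    have hfar : ∑ y with ¬ ∃ x ∈ rS E C (j + 1), E x y, μ y < 1 / 3 := by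
      by_contra h
      obtain ⟨x, hx, y, hy, hxy⟩ := hE _ _ hS (not_lt.1 h)
      simp only [Finset.mem_filter] at hy
      exact hy.2 ⟨x, hx, hxy⟩
    have hunion : ∑ y, μ y ≤ ∑ y ∈ rS E C (j + 2), μ y +
        ∑ y with ∃ m ∈ Finset.Icc 1 (j + 2), (j + 2, y) ∈ C m, μ y +
        ∑ y with ¬ ∃ x ∈ rS E C (j + 1), E x y, μ y := by
      simp only [rS, Finset.sum_filter]
      rw [← Finset.sum_add_distrib, ← Finset.sum_add_distrib]
      refine Finset.sum_le_sum fun y _ => ?_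
      have hy := hμ0 y
      by_cases hcovered : ∃ m ∈ Finset.Icc 1 (j + 2), (j + 2, y) ∈ C m
      · rw [if_pos hcovered]
        split_ifs <;> linarith
      · by_cases hnear : ∃ x ∈ rS E C (j + 1), E x y
        · rw [if_pos ⟨fun m hm hym => hcovered ⟨m, hm, hym⟩, hnear⟩]
          split_ifs <;> linarith
        · rw [if_pos hnear]
          split_ifs <;> linarith
    rw [hμ1] at hunion
    change 1 / 3 ≤ ∑ x ∈ rS E C (j + 2), μ x
    linarith
end

section
/- Suppose W' ⊆ W_B and the labeling l : U_B ∪ W_B → {1,…,R} satisfy every constraint edge (u, w) of the Unique Games instance with w ∈ W'. Remove from G the vertex set {(w, v^α_x) : w ∈ W', x_{l(w)} ∈ {*, 0}} ∪ {(w, v^α_x) : w ∉ W'}. Then in the remaining graph there is no directed path from s_i to t_i for any i ∈ {1,…,k}. -/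
/-- Vertices of the composed graph `G` for Directed Multicut: terminals `s_i`, `t_i`
and `(w, v^α_x)` for `w ∈ W_B`, `α ∈ {1,…,r}^k` (encoded by `α : Fin k → Fin r`, the
value of `α_i` being `(α i).val + 1`) and `x ∈ Ω^R`, where `Ω = {0,…,r-1,*}` is encoded
by `Option (ZMod r)` with `none = *`. -/
inductive GMV (k r R : ℕ) (W : Type) where
  | s (i : Fin k)
  | t (i : Fin k)
  | v (w : W) (α : Fin k → Fin r) (x : Fin R → Option (ZMod r))

/-- Nonterminal edges of `D^M`: `(v^α_x, v^β_y)` with `α ≠ β`, `|α_i - β_i| ≤ 1` for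
every `i`, and every coordinate satisfying `mvStep`. -/
def mvMid {k r R : ℕ} (α β : Fin k → Fin r) (x y : Fin R → Option (ZMod r)) : Prop :=
  α ≠ β ∧ (∀ i, (α i).val ≤ (β i).val + 1 ∧ (β i).val ≤ (α i).val + 1) ∧
    ∀ j, mvStep (x j) (y j)

/-- Directed edges of the composed graph `G`: `s_i → (w, v^α_x)` iff `α_i = 1`;
`(w, v^α_x) → t_i` iff `α_i = r`; and for every `u ∈ U_B`, every pair of neighbors
`w₁, w₂` of `u`, and every nonterminal edge `(v^{α₁}_{x}, v^{α₂}_{y})` of `D^M`, an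
edge from `(w₁, v^{α₁}_{x∘π(u,w₁)})` to `(w₂, v^{α₂}_{y∘π(u,w₂)})`. -/
def gmEdge {k r R : ℕ} {U W : Type} (EB : U → W → Prop)
    (π : U → W → Equiv.Perm (Fin R)) : GMV k r R W → GMV k r R W → Prop
  | .s i, .v _ α _ => (α i).val = 0
  | .v _ α _, .t i => (α i).val = r - 1
  | .v w1 α1 x1, .v w2 α2 x2 =>
      ∃ u, EB u w1 ∧ EB u w2 ∧ ∃ x y, mvMid α1 α2 x y ∧
        x1 = (fun j => x (π u w1 j)) ∧ x2 = (fun j => y (π u w2 j))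
  | _, _ => False

/-- The removed vertex set:
`{(w, v^α_x) : w ∈ W', x_{l(w)} ∈ {*, 0}} ∪ {(w, v^α_x) : w ∉ W'}`. -/
def gmCut {k r R : ℕ} {W : Type} (W' : Set W) (lW : W → Fin R) : Set (GMV k r R W) :=
  {z | ∃ w α x, z = GMV.v w α x ∧
    ((w ∈ W' ∧ (x (lW w) = none ∨ x (lW w) = some 0)) ∨ w ∉ W')}

/-- The vertex is `(w, v^α_x)` with `w ∈ W'` and `x_{l(w)} ∈ {0,…,r-1}` strictly above the
zero-based level `α i`. Every vertex of a path that starts at `s_i` and avoids the cut has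
this property. -/
def AboveLevel {k r R : ℕ} {W : Type} (W' : Set W) (lW : W → Fin R) (i : Fin k) :
    GMV k r R W → Prop
  | .v w α x => w ∈ W' ∧ ∃ c, x (lW w) = some c ∧ (α i).val < c.val
  | _ => False

theorem exists_ne_zero_of_not_mem_gmCut {k r R : ℕ} {W : Type} {W' : Set W}
    {lW : W → Fin R} {w : W} {α : Fin k → Fin r} {x : Fin R → Option (ZMod r)}
    (h : GMV.v w α x ∉ gmCut W' lW) :
    w ∈ W' ∧ ∃ c, x (lW w) = some c ∧ c ≠ 0 := by
  have hw : w ∈ W' := by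
    by_contra hw
    exact h ⟨w, α, x, rfl, Or.inr hw⟩
  refine ⟨hw, ?_⟩
  rcases hc : x (lW w) with _ | c
  · exact (h ⟨w, α, x, rfl, Or.inl ⟨hw, Or.inl hc⟩⟩).elim
  · refine ⟨c, rfl, ?_⟩
    rintro rfl
    exact h ⟨w, α, x, rfl, Or.inl ⟨hw, Or.inr hc⟩⟩

theorem AboveLevel.of_edge_s {k r R : ℕ} {U W : Type} {EB : U → W → Prop}
    {π : U → W → Equiv.Perm (Fin R)} {W' : Set W} {lW : W → Fin R} {i : Fin k}
    {z : GMV k r R W} (he : gmEdge EB π (GMV.s i) z) (hz : z ∉ gmCut W' lW) :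
    AboveLevel W' lW i z := by
  cases z with
  | s _ => exact he
  | t _ => exact he
  | v w α x =>
    obtain ⟨hw, c, hc, hc0⟩ := exists_ne_zero_of_not_mem_gmCut hz
    refine ⟨hw, c, hc, ?_⟩
    have hα : (α i).val = 0 := he
    rw [hα]
    exact Nat.pos_of_ne_zero fun h => hc0 ((ZMod.val_eq_zero c).1 h)

theorem AboveLevel.of_edge {k r R : ℕ} (hr : 2 ≤ r) {U W : Type} {EB : U → W → Prop}
    {π : U → W → Equiv.Perm (Fin R)} {W' : Set W} {lU : U → Fin R} {lW : W → Fin R}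
    (hsat : ∀ u w, EB u w → w ∈ W' → lU u = π u w (lW w)) {i : Fin k}
    {z₁ z₂ : GMV k r R W} (h₁ : AboveLevel W' lW i z₁) (he : gmEdge EB π z₁ z₂)
    (hz : z₂ ∉ gmCut W' lW) (ht : ∀ j, z₂ ≠ GMV.t j) :
    AboveLevel W' lW i z₂ := by
  cases z₁ with
  | s _ => exact h₁.elim
  | t _ => exact h₁.elim
  | v w₁ α₁ x₁ =>
  cases z₂ with
  | s _ => exact he
  | t j => exact (ht j rfl).elim
  | v w₂ α₂ x₂ =>
    obtain ⟨hw₁, c, hc, hlt⟩ := h₁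
    obtain ⟨hw₂, d, hd, hd0⟩ := exists_ne_zero_of_not_mem_gmCut hz
    refine ⟨hw₂, d, hd, ?_⟩
    obtain ⟨u, hu₁, hu₂, x, y, ⟨-, hstep, hxy⟩, rfl, rfl⟩ := he
    simp only [← hsat u w₁ hu₁ hw₁] at hc
    simp only [← hsat u w₂ hu₂ hw₂] at hd
    have hdc : d = c + 1 := by
      have := hxy (lU u)
      simp only [mvStep, hc, hd, Option.some.injEq, reduceCtorEq, or_false] at this
      obtain ⟨_, rfl, h⟩ := this
      exact h
    have : NeZero r := ⟨by omega⟩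
    have hval : d.val = c.val + 1 := by
      have hlt_r : c.val + 1 < r := by
        refine lt_of_le_of_ne (ZMod.val_lt c) fun h => hd0 ?_
        rw [hdc, ← ZMod.natCast_zmod_val c, ← Nat.cast_succ, Nat.succ_eq_add_one, h,
          ZMod.natCast_self]
      have : Fact (1 < r) := ⟨hr⟩
      rw [hdc, ZMod.val_add_of_lt, ZMod.val_one]
      rwa [ZMod.val_one]
    have := (hstep i).2
    omega

theorem AboveLevel.not_edge_t {k r R : ℕ} (hr : 2 ≤ r) {U W : Type} {EB : U → W → Prop}
    {π : U → W → Equiv.Perm (Fin R)} {W' : Set W} {lW : W → Fin R} {i : Fin k}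
    {z : GMV k r R W} (hz : AboveLevel W' lW i z) : ¬ gmEdge EB π z (GMV.t i) := by
  intro he
  cases z with
  | s _ => exact hz
  | t _ => exact hz
  | v w α x =>
    obtain ⟨-, c, -, hlt⟩ := hz
    have hα : (α i).val = r - 1 := he
    have : NeZero r := ⟨by omega⟩
    have := ZMod.val_lt c
    omega

theorem AboveLevel.not_isChain {k r R : ℕ} (hr : 2 ≤ r) {U W : Type} {EB : U → W → Prop}
    {π : U → W → Equiv.Perm (Fin R)} {W' : Set W} {lU : U → Fin R} {lW : W → Fin R}
    (hsat : ∀ u w, EB u w → w ∈ W' → lU u = π u w (lW w)) {i : Fin k}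
    (p : List (GMV k r R W)) (hp : ∀ z ∈ p, z ∉ gmCut W' lW)
    {z : GMV k r R W} (hz : AboveLevel W' lW i z) :
    ¬ List.IsChain (gmEdge EB π) (z :: (p ++ [GMV.t i])) := by
  induction p generalizing z with
  | nil =>
    intro h
    exact hz.not_edge_t hr (List.isChain_cons_cons.1 h).1
  | cons y p ih =>
    intro h
    obtain ⟨he, h⟩ := List.isChain_cons_cons.1 h
    refine ih (fun a ha => hp a (List.mem_cons_of_mem _ ha))
      (hz.of_edge hr hsat he (hp y List.mem_cons_self) ?_) h
    rintro j rfl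
    cases p <;> exact (List.isChain_cons_cons.1 h).1

/-- If the labeling `(lU, lW)` satisfies every constraint edge `(u, w)` of the Unique
Games instance with `w ∈ W'`, then after removing the cut vertices from the composed
graph `G` there is no directed path from `s_i` to `t_i` for any `i`. -/
theorem stmt12 (k r R : ℕ) (hk : 1 ≤ k) (hr : 2 ≤ r) (hR : 1 ≤ R)
    {U W : Type} (EB : U → W → Prop) (π : U → W → Equiv.Perm (Fin R))
    (W' : Set W) (lU : U → Fin R) (lW : W → Fin R)
    (hsat : ∀ u w, EB u w → w ∈ W' → lU u = π u w (lW w))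
    (i : Fin k) :
    ¬ ∃ p : List (GMV k r R W),
        List.Chain (gmEdge EB π) (GMV.s i) (p ++ [GMV.t i]) ∧
          ∀ z ∈ p, z ∉ gmCut W' lW := by
  rintro ⟨p, hchain, hp⟩
  cases p with
  | nil => exact (List.isChain_cons_cons.1 hchain).1
  | cons z p =>
    obtain ⟨he, hchain⟩ := List.isChain_cons_cons.1 hchain
    exact (AboveLevel.of_edge_s he (hp z List.mem_cons_self)).not_isChain hr hsat p
      (fun a ha => hp a (List.mem_cons_of_mem _ ha)) hchain
end

section
/- Suppose W' ⊆ W_B and the labeling l : U_B ∪ W_B → {1,…,R} satisfy every constraint edge (u, w) of the Unique Games instance with w ∈ W'. Remove from G the following edges: for every triple (u, w_1, w_2) with w_1, w_2 neighbors of u, all short edges {(w_1, v^i_x), (w_2, v^{i+1}_y)} with y_{l(w_2)} ≠ x_{l(w_1)} + 1 (mod r) or (x_{l(w_1)}, y_{l(w_2)}) = (0, 1); and all edges incident to vertices (w, ·) with w ∉ W'. Then in the remaining graph every path from s to t has total length at least a·(b − r + 1). -/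
/-- Vertices of the composed graph `G` for Short Path Edge Cut: `s`, `t`, and
`(w, v^i_x)` for `w ∈ W_B`, `0 ≤ i ≤ b`, `x ∈ (ZMod r)^R`. -/
inductive GEV (r R : ℕ) (W : Type) where
  | s | t
  | v (w : W) (i : ℕ) (x : Fin R → ZMod r)

/-- Adjacency-with-length of the composed graph `G` after the removal: the edges
`{s, (w, v^0_x)}` and `{(w, v^b_x), t}` (length `1`) survive iff `w ∈ W'`; a long edge
(length `a`) between `(w₁, v^i_{x∘π(u,w₁)})` and `(w₂, v^{i+1}_{x∘π(u,w₂)})`, for `u`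
a common neighbor of `w₁, w₂`, survives iff `w₁, w₂ ∈ W'`; and a short edge (length `1`)
between `(w₁, v^i_x)` and `(w₂, v^{i+1}_y)`, for `w₁, w₂` with a common neighbor,
survives iff `w₁, w₂ ∈ W'` and not (`y_{l(w₂)} ≠ x_{l(w₁)} + 1` or
`(x_{l(w₁)}, y_{l(w₂)}) = (0, 1)`). -/
def geAdj (a b : ℕ) {r R : ℕ} {U W : Type} (EB : U → W → Prop)
    (π : U → W → Equiv.Perm (Fin R)) (W' : Set W) (lW : W → Fin R) :
    GEV r R W → GEV r R W → ℕ → Prop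
  | .s, .v w i _, n => i = 0 ∧ n = 1 ∧ w ∈ W'
  | .v w i _, .t, n => i = b ∧ n = 1 ∧ w ∈ W'
  | .v w1 i x1, .v w2 j x2, n =>
      j = i + 1 ∧ i < b ∧ w1 ∈ W' ∧ w2 ∈ W' ∧
        ((n = a ∧ ∃ u, EB u w1 ∧ EB u w2 ∧ ∃ x : Fin R → ZMod r,
            x1 = (fun m => x (π u w1 m)) ∧ x2 = (fun m => x (π u w2 m))) ∨
          (n = 1 ∧ (∃ u, EB u w1 ∧ EB u w2) ∧
            ¬(x2 (lW w2) ≠ x1 (lW w1) + 1 ∨ (x1 (lW w1) = 0 ∧ x2 (lW w2) = 1))))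
  | _, _, _ => False

theorem ZMod.val_add_one_of_add_one_ne_zero_s13 {r : ℕ} (hr : 2 ≤ r) {d : ZMod r} (hd : d + 1 ≠ 0) :
    (d + 1).val = d.val + 1 := by
  have : NeZero r := ⟨by lia⟩
  have : Fact (1 < r) := ⟨hr⟩
  have hlt : d.val + 1 < r := by
    refine lt_of_le_of_ne (ZMod.val_lt d) fun h => hd ?_
    have h' := congrArg (Nat.cast : ℕ → ZMod r) h
    simpa using h'
  rw [ZMod.val_add_of_lt (by rwa [ZMod.val_one]), ZMod.val_one]

/-- The potential of a vertex: `a` times (layer minus the position of the labeled coordinate in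
the order `1, 2, …, r - 1, 0`), clamped to `[0, T]`, with `s` at the bottom and `t` at the top. -/
def gePotential (a : ℕ) (T : ℤ) {r R : ℕ} {W : Type} (lW : W → Fin R) : GEV r R W → ℤ
  | .s => 0
  | .t => T
  | .v w i x => min T (max 0 (a * ((i : ℤ) - ((x (lW w) - 1).val : ℤ))))

theorem abs_gePotential_sub_le {a b r R : ℕ} (hr : 2 ≤ r) {T : ℤ} (hT : 0 ≤ T)
    (hTb : T = 0 ∨ T ≤ a * ((b : ℤ) - r + 1))
    {U W : Type} {EB : U → W → Prop} {π : U → W → Equiv.Perm (Fin R)}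
    {W' : Set W} {lU : U → Fin R} {lW : W → Fin R}
    (hsat : ∀ u w, EB u w → w ∈ W' → lU u = π u w (lW w))
    {p q : GEV r R W} {n : ℕ} (h : geAdj a b EB π W' lW p q n) :
    |gePotential a T lW q - gePotential a T lW p| ≤ n := by
  have : NeZero r := ⟨by lia⟩
  match p, q, h with
  | .s, .v w i x, h =>
    obtain ⟨rfl, rfl, -⟩ := h
    have : (a : ℤ) * (((0 : ℕ) : ℤ) - ((x (lW w) - 1).val : ℤ)) ≤ 0 := by
      push_cast
      rw [zero_sub, mul_neg, neg_nonpos]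
      positivity
    simp only [gePotential]
    rw [max_eq_left this, min_eq_right hT]
    simp
  | .v w i x, .t, h =>
    obtain ⟨rfl, rfl, -⟩ := h
    simp only [gePotential]
    rw [min_eq_left]
    · simp
    rcases hTb with rfl | hTb
    · exact le_max_left _ _
    · refine le_max_of_le_right (hTb.trans ?_)
      have := ZMod.val_lt (x (lW w) - 1)
      gcongr
      lia
  | .v w₁ i x₁, .v w₂ j x₂, h =>
    obtain ⟨rfl, -, hw₁, hw₂, ⟨rfl, u, hu₁, hu₂, x, rfl, rfl⟩ | ⟨rfl, -, hne⟩⟩ := h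
    · simp only [gePotential, ← hsat u w₁ hu₁ hw₁, ← hsat u w₂ hu₂ hw₂]
      push_cast
      rw [show (n : ℤ) * ((i : ℤ) + 1 - ((x (lU u) - 1).val : ℤ)) =
        n * ((i : ℤ) - ((x (lU u) - 1).val : ℤ)) + n by ring, abs_le]
      lia
    · push Not at hne
      obtain ⟨hx, h0⟩ := hne
      have hx₁ : x₁ (lW w₁) ≠ 0 := fun h => h0 h (by simp [hx, h])
      have hval := ZMod.val_add_one_of_add_one_ne_zero_s13 hr (d := x₁ (lW w₁) - 1) (by simpa)
      rw [sub_add_cancel] at hval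
      simp only [gePotential, hx, add_sub_cancel_right, hval]
      push_cast
      simp

theorem Fin.le_add_sum_of_succ_le {n : ℕ} (f : Fin (n + 1) → ℤ) (g : Fin n → ℤ)
    (h : ∀ j : Fin n, f j.succ ≤ f j.castSucc + g j) : f (Fin.last n) ≤ f 0 + ∑ j, g j := by
  induction n with
  | zero => simp
  | succ n ih =>
    have h₁ := ih (fun j => f j.castSucc) (fun j => g j.castSucc) fun j => h j.castSucc
    have h₂ := h (Fin.last n)
    rw [Fin.sum_univ_castSucc]
    simp only [Fin.succ_last, Fin.castSucc_zero] at h₁ h₂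
    linarith

/-- If the labeling `(lU, lW)` satisfies every constraint edge `(u, w)` of the Unique
Games instance with `w ∈ W'`, then after removing from `G` the label-cut short edges and
all edges incident to vertices `(w, ·)` with `w ∉ W'`, every path from `s` to `t` has
total length at least `a·(b - r + 1)`. -/
theorem stmt13 (a b r R : ℕ) (ha : 1 ≤ a) (hb : 1 ≤ b) (hr : 2 ≤ r) (hR : 1 ≤ R)
    {U W : Type} (EB : U → W → Prop) (π : U → W → Equiv.Perm (Fin R))
    (W' : Set W) (lU : U → Fin R) (lW : W → Fin R)
    (hsat : ∀ u w, EB u w → w ∈ W' → lU u = π u w (lW w))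
    (n : ℕ) (p : Fin (n + 1) → GEV r R W) (ℓ : Fin n → ℕ)
    (hs : p 0 = GEV.s) (ht : p (Fin.last n) = GEV.t)
    (hadj : ∀ j : Fin n, geAdj a b EB π W' lW (p j.castSucc) (p j.succ) (ℓ j) ∨
      geAdj a b EB π W' lW (p j.succ) (p j.castSucc) (ℓ j)) :
    (a : ℤ) * ((b : ℤ) - (r : ℤ) + 1) ≤ ∑ j, (ℓ j : ℤ) := by
  set T : ℤ := max 0 (a * ((b : ℤ) - r + 1)) with hT
  have key := Fin.le_add_sum_of_succ_le (fun j => gePotential a T lW (p j)) (fun j => (ℓ j : ℤ))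
    fun j => by
      have hTb : T = 0 ∨ T ≤ a * ((b : ℤ) - r + 1) := by grind
      have h₀ : 0 ≤ T := le_max_left _ _
      rcases hadj j with h | h <;>
      · have := abs_le.1 (abs_gePotential_sub_le hr h₀ hTb hsat h)
        lia
  simp only [hs, ht, gePotential, zero_add] at key
  exact (le_max_right _ _).trans key
end

section
/- Suppose W' ⊆ W_B and the labeling l : U_B ∪ W_B → {1,…,R} satisfy every constraint edge (u, w) of the Unique Games instance with w ∈ W'. Remove from G the vertex set {(w, v^i_x) : w ∈ W', x_{l(w)} ∈ {*, 0}} ∪ {(w, v^i_x) : w ∉ W'}. Then in the remaining graph every path from s to t has total length at least a·(b − r + 2). -/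
/-- Vertices of the composed graph `G` for Short Path Vertex Cut: `s`, `t`, and
`(w, v^i_x)` for `w ∈ W_B`, `0 ≤ i ≤ b`, `x ∈ Ω^R`, where `Ω = {0,…,r-1,*}` is encoded
by `Option (ZMod r)` with `none = *`. -/
inductive GVV (r R : ℕ) (W : Type) where
  | s | t
  | v (w : W) (i : ℕ) (x : Fin R → Option (ZMod r))

/-- Adjacency-with-length of the composed graph `G`: `{s, (w, v^i_x)}` has length
`a·i + 1` and `{(w, v^i_x), t}` has length `(b-i)·a + 1`; and for every `u ∈ U_B`, every
pair of neighbors `w₁, w₂` of `u`, and every compatible pair `x, y`, a short edge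
(length `1`) between `(w₁, v^i_{x∘π(u,w₁)})` and `(w₂, v^{i+1}_{y∘π(u,w₂)})`, and a long
edge (length `(j-i)·a`) between `(w₁, v^i_{x∘π(u,w₁)})` and `(w₂, v^j_{y∘π(u,w₂)})` for
`i + 1 < j ≤ b`. -/
def gvAdj (a b : ℕ) {r R : ℕ} {U W : Type} (EB : U → W → Prop)
    (π : U → W → Equiv.Perm (Fin R)) : GVV r R W → GVV r R W → ℕ → Prop
  | .s, .v _ i _, n => i ≤ b ∧ n = a * i + 1
  | .v _ i _, .t, n => i ≤ b ∧ n = (b - i) * a + 1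
  | .v w1 i x1, .v w2 j x2, n =>
      j ≤ b ∧
        (∃ u, EB u w1 ∧ EB u w2 ∧ ∃ x y, vcomp x y ∧
          x1 = (fun m => x (π u w1 m)) ∧ x2 = (fun m => y (π u w2 m))) ∧
        ((j = i + 1 ∧ n = 1) ∨ (i + 1 < j ∧ n = (j - i) * a))
  | _, _, _ => False

/-- The removed vertex set:
`{(w, v^i_x) : w ∈ W', x_{l(w)} ∈ {*, 0}} ∪ {(w, v^i_x) : w ∉ W'}`. -/
def gvCut {r R : ℕ} {W : Type} (W' : Set W) (lW : W → Fin R) : Set (GVV r R W) :=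
  {z | ∃ w i x, z = GVV.v w i x ∧
    ((w ∈ W' ∧ (x (lW w) = none ∨ x (lW w) = some 0)) ∨ w ∉ W')}

/-- The value of a coordinate of `Ω`, with `*` sent to `0`. -/
def coordVal {r : ℕ} (o : Option (ZMod r)) : ℤ := o.elim 0 fun c => (c.val : ℤ)

/-- The potential `i - x_{l(w)}` of the vertex `(w, v^i_x)`, clamped between its values `-1` at `s`
and `b - r + 1` at `t`. -/
def gvPotential (b : ℕ) {r R : ℕ} {W : Type} (lW : W → Fin R) : GVV r R W → ℤ
  | .s => -1
  | .t => (b : ℤ) - r + 1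
  | .v w i x => min (max ((i : ℤ) - coordVal (x (lW w))) (-1)) ((b : ℤ) - r + 1)

theorem ZMod.val_add_one_of_ne_zero {r : ℕ} [NeZero r] (c : ZMod r) (h : c + 1 ≠ 0) :
    (c + 1).val = c.val + 1 := by
  have hlt := ZMod.val_lt c
  have hne : c.val + 1 ≠ r := fun he => h <| by
    have := congrArg (Nat.cast : ℕ → ZMod r) he
    simpa using this
  rw [← ZMod.natCast_zmod_val c, ← Nat.cast_succ, ZMod.val_natCast_of_lt (by omega),
    ZMod.val_natCast_of_lt hlt]

theorem mem_of_notMem_gvCut {r R : ℕ} {W : Type} {W' : Set W} {lW : W → Fin R} {w : W} {i : ℕ}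
    {x : Fin R → Option (ZMod r)} (h : GVV.v w i x ∉ gvCut W' lW) :
    w ∈ W' ∧ x (lW w) ≠ none ∧ x (lW w) ≠ some 0 := by
  by_contra hc
  refine h ⟨w, i, x, rfl, ?_⟩
  tauto

theorem coordVal_bounds {r : ℕ} [NeZero r] {o : Option (ZMod r)} (hn : o ≠ none)
    (h0 : o ≠ some 0) : 1 ≤ coordVal o ∧ coordVal o ≤ (r : ℤ) - 1 := by
  obtain ⟨c, rfl⟩ := Option.ne_none_iff_exists'.mp hn
  have h1 : c.val ≠ 0 := fun h => h0 (congrArg some ((ZMod.val_eq_zero c).mp h))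
  have h2 := ZMod.val_lt c
  simp only [coordVal, Option.elim]
  omega

/-- Along an edge between surviving non-terminal vertices the labelled coordinate goes up by one. -/
theorem coordVal_succ {r R : ℕ} [NeZero r] {U W : Type} {EB : U → W → Prop}
    {π : U → W → Equiv.Perm (Fin R)} {W' : Set W} {lU : U → Fin R} {lW : W → Fin R}
    (hsat : ∀ u w, EB u w → w ∈ W' → lU u = π u w (lW w)) {w₁ w₂ : W} {i j : ℕ}
    {x₁ x₂ : Fin R → Option (ZMod r)}
    (h₁ : GVV.v w₁ i x₁ ∉ gvCut W' lW) (h₂ : GVV.v w₂ j x₂ ∉ gvCut W' lW)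
    (he : ∃ u, EB u w₁ ∧ EB u w₂ ∧ ∃ x y, vcomp x y ∧
      x₁ = (fun m => x (π u w₁ m)) ∧ x₂ = (fun m => y (π u w₂ m))) :
    coordVal (x₂ (lW w₂)) = coordVal (x₁ (lW w₁)) + 1 := by
  obtain ⟨u, hu₁, hu₂, x, y, hc, rfl, rfl⟩ := he
  obtain ⟨hw₁, hn₁, -⟩ := mem_of_notMem_gvCut h₁
  obtain ⟨hw₂, hn₂, h0₂⟩ := mem_of_notMem_gvCut h₂
  simp only [← hsat u w₁ hu₁ hw₁] at hn₁ ⊢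
  simp only [← hsat u w₂ hu₂ hw₂] at hn₂ h0₂ ⊢
  rcases hc (lU u) with ⟨c, hx, hy⟩ | hy | hx
  · rw [hy] at h0₂
    simp only [hx, hy, coordVal, Option.elim,
      ZMod.val_add_one_of_ne_zero c fun h => h0₂ (congrArg some h), Nat.cast_succ]
  · exact absurd hy hn₂
  · exact absurd hx hn₁

/-- The potential varies by at most `n / a` along an edge of length `n`. -/
theorem gvPotential_sub_le {a b r R : ℕ} [NeZero r] (hrb : r ≤ b + 2) {U W : Type}
    {EB : U → W → Prop}
    {π : U → W → Equiv.Perm (Fin R)} {W' : Set W} {lU : U → Fin R} {lW : W → Fin R}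
    (hsat : ∀ u w, EB u w → w ∈ W' → lU u = π u w (lW w)) {z z' : GVV r R W} {n : ℕ}
    (hz : z ∉ gvCut W' lW) (hz' : z' ∉ gvCut W' lW) (h : gvAdj a b EB π z z' n) :
    (a : ℤ) * (gvPotential b lW z' - gvPotential b lW z) ≤ n ∧
      (a : ℤ) * (gvPotential b lW z - gvPotential b lW z') ≤ n := by
  have key : ∃ k : ℤ, (a : ℤ) * k ≤ n ∧ gvPotential b lW z' - gvPotential b lW z ≤ k ∧
      gvPotential b lW z - gvPotential b lW z' ≤ k := by
    rcases z with _ | _ | ⟨w₁, i, x₁⟩ <;> rcases z' with _ | _ | ⟨w₂, j, x₂⟩ <;>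
      simp only [gvAdj] at h
    · obtain ⟨-, rfl⟩ := h
      obtain ⟨-, hn, h0⟩ := mem_of_notMem_gvCut hz'
      have := coordVal_bounds hn h0
      refine ⟨j, by push_cast; omega, ?_, ?_⟩ <;> simp only [gvPotential] <;> omega
    · obtain ⟨hib, rfl⟩ := h
      obtain ⟨-, hn, h0⟩ := mem_of_notMem_gvCut hz
      have := coordVal_bounds hn h0
      refine ⟨(b : ℤ) - i, by push_cast [Nat.cast_sub hib]; linarith, ?_, ?_⟩ <;>
        simp only [gvPotential] <;> omega
    · obtain ⟨-, he, h⟩ := h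
      have hs := coordVal_succ hsat hz hz' he
      rcases h with ⟨rfl, rfl⟩ | ⟨hij, rfl⟩
      · refine ⟨0, by simp, ?_, ?_⟩ <;> simp only [gvPotential] <;> omega
      · refine ⟨(j : ℤ) - i, by push_cast [Nat.cast_sub (by omega : i ≤ j)]; linarith, ?_, ?_⟩ <;>
          simp only [gvPotential] <;> omega
  obtain ⟨k, hk, h1, h2⟩ := key
  have ha : (0 : ℤ) ≤ a := Int.natCast_nonneg a
  exact ⟨(mul_le_mul_of_nonneg_left h1 ha).trans hk, (mul_le_mul_of_nonneg_left h2 ha).trans hk⟩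

/-- If the labeling `(lU, lW)` satisfies every constraint edge `(u, w)` of the Unique
Games instance with `w ∈ W'`, then after removing the cut vertices from `G` every path
from `s` to `t` has total length at least `a·(b - r + 2)`. -/
theorem stmt14 (a b r R : ℕ) (ha : 1 ≤ a) (hb : 1 ≤ b) (hr : 2 ≤ r) (hR : 1 ≤ R)
    {U W : Type} (EB : U → W → Prop) (π : U → W → Equiv.Perm (Fin R))
    (W' : Set W) (lU : U → Fin R) (lW : W → Fin R)
    (hsat : ∀ u w, EB u w → w ∈ W' → lU u = π u w (lW w))
    (n : ℕ) (p : Fin (n + 1) → GVV r R W) (ℓ : Fin n → ℕ)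
    (hs : p 0 = GVV.s) (ht : p (Fin.last n) = GVV.t)
    (hadj : ∀ j : Fin n, gvAdj a b EB π (p j.castSucc) (p j.succ) (ℓ j) ∨
      gvAdj a b EB π (p j.succ) (p j.castSucc) (ℓ j))
    (havoid : ∀ j, p j ∉ gvCut W' lW) :
    (a : ℤ) * ((b : ℤ) - (r : ℤ) + 2) ≤ ∑ j, (ℓ j : ℤ) := by
  have : NeZero r := ⟨by omega⟩
  rcases lt_or_ge (b + 2) r with hrb | hrb
  · calc (a : ℤ) * ((b : ℤ) - r + 2) ≤ 0 :=
          mul_nonpos_of_nonneg_of_nonpos (by omega) (by omega)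
      _ ≤ ∑ j, (ℓ j : ℤ) := Finset.sum_nonneg fun j _ => Int.natCast_nonneg _
  have hstep (j : Fin n) :
      (a : ℤ) * (gvPotential b lW (p j.succ) - gvPotential b lW (p j.castSucc)) ≤ ℓ j :=
    (hadj j).elim
      (fun h => (gvPotential_sub_le hrb hsat (havoid _) (havoid _) h).1)
      (fun h => (gvPotential_sub_le hrb hsat (havoid _) (havoid _) h).2)
  have htel : ∑ j : Fin n, (gvPotential b lW (p j.succ) - gvPotential b lW (p j.castSucc)) =
      gvPotential b lW (p (Fin.last n)) - gvPotential b lW (p 0) := by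
    rw [Finset.sum_sub_distrib]
    have h1 := Fin.sum_univ_succ fun j => gvPotential b lW (p j)
    have h2 := Fin.sum_univ_castSucc fun j => gvPotential b lW (p j)
    linarith
  calc (a : ℤ) * ((b : ℤ) - r + 2)
      = ∑ j : Fin n, a * (gvPotential b lW (p j.succ) - gvPotential b lW (p j.castSucc)) := by
        rw [← Finset.mul_sum, htel, hs, ht]
        simp only [gvPotential]
        ring
    _ ≤ ∑ j, (ℓ j : ℤ) := Finset.sum_le_sum fun j _ => hstep j
end
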